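/- arXiv:1905.01836 — 2 statements merged into one kernel-verified Lean document; each statement's English description precedes it below -/
import Mathlib

section
/- If the sign pattern Σ_{m,n,q} (with m, n, q ≥ 1, m + n + q = d + 1) is realizable with the pair (0, d−2), then it is realizable with every pair of the form (0, d−2k) for k = 1, …, ⌊(d−2)/2⌋. -/
open Polynomial

/-- A real polynomial `P` realizes the pair `(pos, neg)` if it has exactly `pos`
distinct positive roots and exactly `neg` distinct negative roots, all of them
simple, and no other real roots. -/
def realizesPair (P : Polynomial ℝ) (pos neg : ℕ) : Prop :=
  P.roots.Nodup ∧
  (P.roots.filter (fun x => 0 < x)).card = pos ∧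
  (P.roots.filter (fun x => x < 0)).card = neg ∧
  (0 : ℝ) ∉ P.roots

/-- `P` defines the sign pattern `Σ_{m,n,q}` (with `m + n + q = d + 1`):
`m` pluses, then `n` minuses, then `q` pluses; in coefficient indexing,
`coeff j > 0` for `j < q`, `coeff j < 0` for `q ≤ j < q + n`, and
`coeff j > 0` for `q + n ≤ j ≤ d`. -/
def definesSigma (P : Polynomial ℝ) (d n q : ℕ) : Prop :=
  (∀ j, j < q → 0 < P.coeff j) ∧
  (∀ j, q ≤ j → j < q + n → P.coeff j < 0) ∧
  (∀ j, q + n ≤ j → j ≤ d → 0 < P.coeff j)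

open Filter Topology Set

namespace Multiset

theorem exists_univ_val_map_eq {α : Type*} (s : Multiset α) {n : ℕ} (hs : s.card = n) :
    ∃ f : Fin n → α, s = (Finset.univ : Finset (Fin n)).val.map f := by
  subst hs
  induction s using Quotient.inductionOn with
  | h l =>
    have h : (l : Multiset α) = (Finset.univ : Finset (Fin l.length)).val.map l.get := by
      rw [Fin.univ_val_map, List.ofFn_get]
    exact ⟨l.get, h⟩

/-- A multiset with fewer than `n` elements of odd multiplicity can be shrunk to any size `n` of the
right parity by removing equal pairs. -/
theorem exists_eq_add_add_self {α : Type*} [DecidableEq α] (n k : ℕ) (s : Multiset α)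
    (hs : s.card = n + 2 * k) (hodd : (s.toFinset.filter fun a => Odd (s.count a)).card ≤ n) :
    ∃ u v : Multiset α, s = u + (v + v) ∧ u.card = n ∧ v.card = k := by
  induction k generalizing s with
  | zero => exact ⟨s, 0, by simp, by simpa using hs, rfl⟩
  | succ k ih =>
    have hdup : ¬ s.Nodup := by
      intro hnd
      have h1 : (s.toFinset.filter fun a => Odd (s.count a)) = s.toFinset :=
        Finset.filter_true_of_mem fun a ha => by
          rw [Multiset.count_eq_one_of_mem hnd (Multiset.mem_toFinset.1 ha)]
          exact odd_one
      rw [h1, Multiset.toFinset_card_of_nodup hnd] at hodd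
      omega
    obtain ⟨a, ha⟩ : ∃ a, 1 < s.count a := by
      simpa [Multiset.nodup_iff_count_le_one] using hdup
    obtain ⟨t, rfl⟩ : ∃ t, s = Multiset.replicate 2 a + t :=
      Multiset.le_iff_exists_add.1 (Multiset.le_count_iff_replicate_le.1 ha)
    have hset : (t.toFinset.filter fun b => Odd (t.count b)) =
        ((Multiset.replicate 2 a + t).toFinset.filter
          fun b => Odd ((Multiset.replicate 2 a + t).count b)) := by
      ext b
      have key : ∀ u : Multiset α, b ∈ (u.toFinset.filter fun b => Odd (u.count b)) ↔
          Odd (u.count b) := by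
        intro u
        simp only [Finset.mem_filter, Multiset.mem_toFinset, and_iff_right_iff_imp]
        intro h
        exact Multiset.count_pos.1 h.pos
      rw [key, key, Multiset.count_add, Multiset.count_replicate]
      simp only [Nat.odd_iff]
      split_ifs <;> omega
    obtain ⟨u, v, h1, h2, h3⟩ := ih t (by simp at hs; omega) (hset ▸ hodd)
    refine ⟨u, a ::ₘ v, ?_, h2, by simp [h3]⟩
    rw [h1, show Multiset.replicate 2 a = {a} + {a} from rfl, ← Multiset.singleton_add]
    abel

end Multiset

namespace Polynomial

theorem exists_isRoot_of_monic_of_odd_natDegree {P : ℝ[X]} (hP : P.Monic)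
    (hodd : Odd P.natDegree) : ∃ x, P.IsRoot x := by
  have hdeg : 0 < P.degree := natDegree_pos_iff_degree_pos.1 hodd.pos
  have h1 := P.tendsto_atTop_of_leadingCoeff_nonneg hdeg (by simp [hP.leadingCoeff])
  have h2 := (P.comp (-X)).tendsto_atBot_of_leadingCoeff_nonpos
    (natDegree_pos_iff_degree_pos.1 (by simpa [natDegree_comp] using hodd.pos))
    (by rw [leadingCoeff_comp (by simp)]; simp [hP.leadingCoeff, hodd.neg_one_pow])
  obtain ⟨x, hx⟩ := (h1.eventually (eventually_ge_atTop 0)).exists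
  obtain ⟨y, hy⟩ := (h2.eventually (eventually_le_atBot 0)).exists
  obtain ⟨z, hz⟩ := mem_range_of_exists_le_of_exists_ge P.continuous
    ⟨-y, by simpa using hy⟩ ⟨x, hx⟩
  exact ⟨z, hz⟩

theorem eval_pos_of_forall_not_isRoot {P : ℝ[X]} (h0 : 0 < P.coeff 0)
    (hroot : ∀ x, 0 < x → ¬ P.IsRoot x) {x : ℝ} (hx : 0 ≤ x) : 0 < P.eval x := by
  by_contra! hneg
  rw [coeff_zero_eq_eval_zero] at h0
  obtain ⟨y, hy, hy0⟩ := intermediate_value_Icc' hx P.continuous.continuousOn ⟨hneg, h0.le⟩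
  rcases hy.1.eq_or_lt with rfl | hlt
  · exact h0.ne' hy0
  · exact hroot y hlt hy0

/-- For large constants `t`, the polynomial `P + t` has at most one real root, provided it has no
nonnegative ones. -/
theorem exists_forall_card_roots_add_C_le_one {P : ℝ[X]} (hP : 0 < P.natDegree)
    (hpos : ∀ x, 0 ≤ x → 0 < P.eval x) :
    ∃ T : ℝ, 0 ≤ T ∧ ∀ t, T < t → (P + C t).roots.card ≤ 1 := by
  have hP' : derivative P ≠ 0 := fun h => hP.ne' (derivative_eq_zero.1 h)
  obtain ⟨b, hb⟩ := (derivative P).roots.toFinset.bddBelow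
  have hbr : ∀ c, (derivative P).eval c = 0 → b ≤ c := fun c hc =>
    hb (by simpa [hP'] using hc)
  obtain ⟨T, hT⟩ := (isCompact_Icc (a := b) (b := 0)).exists_bound_of_continuousOn
    P.continuous.continuousOn
  refine ⟨max T 0, le_max_right _ _, fun t ht => ?_⟩
  have hroot : ∀ x, (P + C t).IsRoot x → x < b := by
    intro x hx
    have hx' : P.eval x + t = 0 := by simpa [IsRoot] using hx
    by_contra! hbx
    rcases le_total 0 x with h0 | h0
    · have := hpos x h0
      linarith [le_max_right T 0]
    · have := hT x ⟨hbx, h0⟩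
      rw [Real.norm_eq_abs] at this
      linarith [neg_abs_le (P.eval x), le_max_left T 0]
  have hder : derivative (P + C t) = derivative P := by simp
  have hne : P + C t ≠ 0 := by
    intro h
    rw [h, derivative_zero] at hder
    exact hP' hder.symm
  have hnd : (P + C t).roots.Nodup := by
    rw [Multiset.nodup_iff_count_le_one]
    intro a
    by_contra! h
    rw [count_roots, one_lt_rootMultiplicity_iff_isRoot hne, hder] at h
    exact absurd (hroot a h.1) (hbr a h.2).not_gt
  have hrolle : ∀ x y, (P + C t).IsRoot x → (P + C t).IsRoot y → ¬ x < y := by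
    intro x y hx hy hxy
    obtain ⟨c, hc, hc0⟩ := exists_deriv_eq_zero hxy (P + C t).continuous.continuousOn
      (hx.trans hy.symm)
    rw [Polynomial.deriv, hder] at hc0
    exact absurd (hc.2.trans (hroot y hy)) (hbr c hc0).not_gt
  rw [← Multiset.toFinset_card_of_nodup hnd, Finset.card_le_one]
  intro x hx y hy
  rw [Multiset.mem_toFinset] at hx hy
  rcases lt_trichotomy x y with h | h | h
  · exact absurd h (hrolle _ _ (isRoot_of_mem_roots hx) (isRoot_of_mem_roots hy))
  · exact h
  · exact absurd h (hrolle _ _ (isRoot_of_mem_roots hy) (isRoot_of_mem_roots hx))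

theorem eventually_eval_sub_mul_eval_add_neg {F : ℝ[X]} (hF : F ≠ 0) {r : ℝ}
    (hr : Odd (F.rootMultiplicity r)) :
    ∀ᶠ δ in 𝓝[>] (0 : ℝ), F.eval (r - δ) * F.eval (r + δ) < 0 := by
  obtain ⟨G, hG, hnd⟩ := exists_eq_pow_rootMultiplicity_mul_and_not_dvd F hF r
  have hGr : G.eval r ≠ 0 := fun h => hnd (dvd_iff_isRoot.2 h)
  have hc : Continuous fun δ : ℝ => G.eval (r - δ) * G.eval (r + δ) := by fun_prop
  have hev : ∀ᶠ δ in 𝓝 (0 : ℝ), 0 < G.eval (r - δ) * G.eval (r + δ) :=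
    hc.continuousAt.eventually_const_lt (by simpa using mul_self_pos.2 hGr)
  filter_upwards [hev.filter_mono nhdsWithin_le_nhds, self_mem_nhdsWithin] with δ h1 h2
  rw [hG]
  set m := F.rootMultiplicity r
  have h3 : 0 < δ ^ m := pow_pos h2 m
  have : ((X - C r) ^ m * G).eval (r - δ) * ((X - C r) ^ m * G).eval (r + δ) =
      -(δ ^ m * δ ^ m * (G.eval (r - δ) * G.eval (r + δ))) := by
    simp only [eval_mul, eval_pow, eval_sub, eval_X, eval_C]
    rw [show r - δ - r = -δ by ring, show r + δ - r = δ by ring, hr.neg_pow]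
    ring
  rw [this, neg_lt_zero]
  positivity

/-- Roots of odd multiplicity persist under small perturbations of the constant coefficient. -/
theorem eventually_card_le_card_roots_add_C {F : ℝ[X]} (hF : 0 < F.natDegree) (S : Finset ℝ)
    (hS : ∀ r ∈ S, Odd (F.rootMultiplicity r)) :
    ∀ᶠ t in 𝓝 (0 : ℝ), S.card ≤ (F + C t).roots.card := by
  have hF0 : F ≠ 0 := by rintro rfl; simp at hF
  have hsep : ∀ᶠ δ in 𝓝[>] (0 : ℝ), ∀ r ∈ S, ∀ r' ∈ S, r < r' → r + δ < r' - δ := by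
    simp only [Finset.eventually_all]
    intro r _ r' _
    rw [eventually_imp_distrib_left]
    intro h
    refine Eventually.filter_mono nhdsWithin_le_nhds ?_
    have h1 : Continuous fun δ : ℝ => r + δ := by fun_prop
    have h2 : Continuous fun δ : ℝ => r' - δ := by fun_prop
    exact h1.continuousAt.eventually_lt h2.continuousAt (by simpa using h)
  have hsign : ∀ᶠ δ in 𝓝[>] (0 : ℝ), ∀ r ∈ S, F.eval (r - δ) * F.eval (r + δ) < 0 := by
    simp only [Finset.eventually_all]
    exact fun r hr => eventually_eval_sub_mul_eval_add_neg hF0 (hS r hr)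
  obtain ⟨δ, ⟨hsep, hsign⟩, hδ⟩ := ((hsep.and hsign).and self_mem_nhdsWithin).exists
  have hδ : 0 < δ := hδ
  have hev : ∀ᶠ t in 𝓝 (0 : ℝ), ∀ r ∈ S,
      (F.eval (r - δ) + t) * (F.eval (r + δ) + t) < 0 := by
    simp only [Finset.eventually_all]
    intro r hr
    have hc : Continuous fun t : ℝ => (F.eval (r - δ) + t) * (F.eval (r + δ) + t) := by fun_prop
    exact hc.continuousAt.eventually_lt_const (by simpa using hsign r hr)
  filter_upwards [hev] with t ht
  have hne : F + C t ≠ 0 := by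
    intro h
    have := congrArg natDegree h
    rw [natDegree_add_C, natDegree_zero] at this
    omega
  have hroot : ∀ r ∈ S, ∃ y ∈ Ioo (r - δ) (r + δ), (F + C t).IsRoot y := by
    intro r hr
    have h1 := ht r hr
    have hc : ContinuousOn (fun x => (F + C t).eval x) (Icc (r - δ) (r + δ)) :=
      (F + C t).continuous.continuousOn
    rcases mul_neg_iff.1 h1 with ⟨ha, hb⟩ | ⟨ha, hb⟩
    · obtain ⟨y, hy, hy0⟩ := intermediate_value_Ioo' (by linarith) hc
        (show (0 : ℝ) ∈ Ioo _ _ from ⟨by simpa using hb, by simpa using ha⟩)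
      exact ⟨y, hy, hy0⟩
    · obtain ⟨y, hy, hy0⟩ := intermediate_value_Ioo (by linarith) hc
        (show (0 : ℝ) ∈ Ioo _ _ from ⟨by simpa using ha, by simpa using hb⟩)
      exact ⟨y, hy, hy0⟩
  choose! y hy hy0 using hroot
  calc S.card ≤ (F + C t).roots.toFinset.card := by
        refine Finset.card_le_card_of_injOn y (fun r hr => ?_) ?_
        · simpa [hne] using hy0 r hr
        · intro a ha b hb hab
          have ha' := hy a ha
          have hb' := hy b hb
          rw [hab] at ha'
          rcases lt_trichotomy a b with h | h | h
          · linarith [hsep a ha b hb h, ha'.2, hb'.1]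
          · exact h
          · linarith [hsep b hb a ha h, ha'.1, hb'.2]
    _ ≤ (F + C t).roots.card := Multiset.toFinset_card_le _

theorem exists_norm_root_add_C_le {P : ℂ[X]} (hP : 0 < P.natDegree) (T : ℝ) :
    ∃ B : ℝ, 0 ≤ B ∧ ∀ z c : ℂ, ‖c‖ ≤ T → P.eval z + c = 0 → ‖z‖ ≤ B := by
  have h := (P.tendsto_norm_atTop (natDegree_pos_iff_degree_pos.1 hP)
    (l := comap norm atTop) (z := id) tendsto_comap).eventually_gt_atTop T
  rw [eventually_comap, eventually_atTop] at h
  obtain ⟨B, hB⟩ := h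
  refine ⟨max B 0, le_max_right _ _, fun z c hc hz => ?_⟩
  by_contra! hlt
  have h1 : T < ‖P.eval z‖ := hB ‖z‖ ((le_max_left _ _).trans hlt.le) z rfl
  rw [eq_neg_of_add_eq_zero_left hz, norm_neg] at h1
  exact h1.not_ge hc

theorem roots_prod_univ_X_sub_C {R ι : Type*} [CommRing R] [IsDomain R] [Fintype ι] (r : ι → R) :
    (∏ i, (X - C (r i))).roots = Finset.univ.val.map r := by
  rw [← roots_multiset_prod_X_sub_C (Finset.univ.val.map r), Multiset.map_map,
    Finset.prod_map_val]
  rfl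

theorem le_card_roots_iff_exists_prod {Q : ℝ[X]} (hQ : Q.Monic) {s : ℕ} :
    s ≤ Q.roots.card ↔ ∃ (r : Fin s → ℝ) (z : Fin (Q.natDegree - s) → ℂ),
      ∀ x : ℂ, (∏ i, (x - r i)) * ∏ j, (x - z j) = (Q.map Complex.ofRealHom).eval x := by
  constructor
  · intro hs
    have hchoose : 0 < (Q.roots.powersetCard s).card := by
      rw [Multiset.card_powersetCard]
      exact Nat.choose_pos hs
    obtain ⟨u, hu⟩ := Multiset.card_pos_iff_exists_mem.1 hchoose
    obtain ⟨hu, hcard⟩ := Multiset.mem_powersetCard.1 hu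
    obtain ⟨r, rfl⟩ := u.exists_univ_val_map_eq hcard
    obtain ⟨G, hG⟩ := (Multiset.prod_X_sub_C_dvd_iff_le_roots hQ.ne_zero _).2 hu
    rw [Multiset.map_map, Finset.prod_map_val] at hG
    simp only [Function.comp_apply] at hG
    have hm : (∏ i, (X - C (r i))).Monic := monic_prod_of_monic _ _ fun i _ => monic_X_sub_C _
    have hGm : G.Monic := hm.of_mul_monic_left (hG ▸ hQ)
    have hdeg : G.natDegree = Q.natDegree - s := by
      rw [hG, hm.natDegree_mul hGm, natDegree_prod_of_monic _ _ fun i _ => monic_X_sub_C _]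
      simp
    have hsplit := IsAlgClosed.splits (G.map Complex.ofRealHom)
    obtain ⟨z, hz⟩ := (G.map Complex.ofRealHom).roots.exists_univ_val_map_eq
      (n := Q.natDegree - s) (by rw [splits_iff_card_roots.1 hsplit, natDegree_map, hdeg])
    refine ⟨r, z, fun x => ?_⟩
    rw [congrArg (map Complex.ofRealHom) hG, Polynomial.map_mul, eval_mul, hsplit.eq_prod_roots_of_monic (hGm.map _), hz,
      Multiset.map_map, Finset.prod_map_val, Polynomial.map_prod, eval_prod, eval_prod]
    simp
  · rintro ⟨r, z, h⟩
    have heq : Q.map Complex.ofRealHom =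
        (∏ i, (X - C (r i))).map Complex.ofRealHom * ∏ j, (X - C (z j)) := by
      refine Polynomial.funext fun x => ?_
      rw [← h x, Polynomial.map_prod, eval_mul, eval_prod, eval_prod]
      simp
    have hdvd : (∏ i, (X - C (r i))) ∣ Q := (map_dvd_map' Complex.ofRealHom).1 ⟨_, heq⟩
    have := Multiset.card_le_card (roots.le_of_dvd hQ.ne_zero hdvd)
    rwa [roots_prod_univ_X_sub_C, Multiset.card_map, Finset.card_val, Finset.card_univ,
      Fintype.card_fin] at this

theorem monic_add_C {P : ℝ[X]} (hP : P.Monic) (hdeg : 0 < P.natDegree) (t : ℝ) :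
    (P + C t).Monic :=
  hP.add_of_left (degree_C_le.trans_lt (natDegree_pos_iff_degree_pos.1 hdeg))

/-- The constants `t ∈ [0, T]` for which `P + t` has at least `s` real roots, counted with
multiplicity, form a compact set. -/
theorem isCompact_setOf_le_card_roots_add_C {P : ℝ[X]} (hP : P.Monic) (hdeg : 0 < P.natDegree)
    (s : ℕ) (T : ℝ) : IsCompact {t ∈ Icc 0 T | s ≤ (P + C t).roots.card} := by
  obtain ⟨B, hB0, hB⟩ := exists_norm_root_add_C_le
    (P := P.map Complex.ofRealHom) (by simpa using hdeg) T
  let f : ℝ × (Fin s → ℝ) × (Fin (P.natDegree - s) → ℂ) → ℂ → ℂ := fun p x =>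
    (∏ i, (x - p.2.1 i)) * ∏ j, (x - p.2.2 j)
  have hf : ∀ t, s ≤ (P + C t).roots.card ↔
      ∃ r z, ∀ x, f (t, r, z) x = (P.map Complex.ofRealHom).eval x + t := by
    intro t
    rw [le_card_roots_iff_exists_prod (monic_add_C hP hdeg t), natDegree_add_C]
    simp [f]
  let K : Set (ℝ × (Fin s → ℝ) × (Fin (P.natDegree - s) → ℂ)) :=
    (Icc 0 T ×ˢ Metric.closedBall 0 B ×ˢ Metric.closedBall 0 B) ∩
      {p | ∀ x, f p x = (P.map Complex.ofRealHom).eval x + p.1}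
  have hK : IsCompact K := by
    refine IsCompact.inter_right (isCompact_Icc.prod
      ((isCompact_closedBall _ _).prod (isCompact_closedBall _ _))) ?_
    simp only [ofPred_forall]
    refine isClosed_iInter fun x => isClosed_eq ?_ ?_
    · simp only [f]
      fun_prop
    · fun_prop
  convert hK.image continuous_fst
  ext t
  simp only [mem_ofPred_eq, mem_image, Prod.exists, exists_and_right, exists_eq_right]
  constructor
  · rintro ⟨ht, hs⟩
    obtain ⟨r, z, h⟩ := (hf t).1 hs
    have htn : ‖(t : ℂ)‖ ≤ T := by
      rw [Complex.norm_real, Real.norm_eq_abs, abs_of_nonneg ht.1]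
      exact ht.2
    refine ⟨r, z, ⟨ht, ?_, ?_⟩, h⟩
    · rw [mem_closedBall_zero_iff, pi_norm_le_iff_of_nonneg hB0]
      intro i
      rw [← Complex.norm_real]
      refine hB _ t htn ?_
      rw [← h]
      exact mul_eq_zero_of_left (Finset.prod_eq_zero (Finset.mem_univ i) (sub_self _)) _
    · rw [mem_closedBall_zero_iff, pi_norm_le_iff_of_nonneg hB0]
      intro j
      refine hB _ t htn ?_
      rw [← h]
      exact mul_eq_zero_of_right _ (Finset.prod_eq_zero (Finset.mem_univ j) (sub_self _))
  · rintro ⟨r, z, ⟨ht, -⟩, h⟩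
    exact ⟨ht, (hf t).2 ⟨r, z, h⟩⟩

/-- A monic polynomial with at least `s` real roots, counted with multiplicity, but at most `s`
real roots of odd multiplicity, is a limit of polynomials with exactly `s` real roots, all simple:
equal pairs of roots are made complex conjugate, and the remaining ones are separated. -/
theorem exists_tendsto_card_roots_eq {F : ℝ[X]} (hF : F.Monic) (s k : ℕ)
    (hcard : F.roots.card = s + 2 * k)
    (hodd : (F.roots.toFinset.filter fun r => Odd (F.rootMultiplicity r)).card ≤ s)
    (hneg : ∀ r ∈ F.roots, r < 0) :
    ∃ Q : ℝ → ℝ[X], (∀ ε, (Q ε).Monic) ∧ (∀ ε, (Q ε).natDegree = F.natDegree) ∧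
      (∀ j, Tendsto (fun ε => (Q ε).coeff j) (𝓝[>] 0) (𝓝 (F.coeff j))) ∧
      ∀ᶠ ε in 𝓝[>] 0, (Q ε).roots.Nodup ∧ (Q ε).roots.card = s ∧ ∀ r ∈ (Q ε).roots, r < 0 := by
  simp only [← count_roots] at hodd
  obtain ⟨u, v, huv, hu, hv⟩ := F.roots.exists_eq_add_add_self s k hcard hodd
  obtain ⟨r, rfl⟩ := u.exists_univ_val_map_eq hu
  obtain ⟨c, rfl⟩ := v.exists_univ_val_map_eq hv
  obtain ⟨G, hG, -, hG0⟩ := exists_prod_multiset_X_sub_C_mul F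
  have hGm : G.Monic :=
    (monic_multiset_prod_of_monic _ _ fun a _ => monic_X_sub_C a).of_mul_monic_left (hG ▸ hF)
  let H : ℝ[X][X] := (∏ i : Fin s, (X - C (C (r i) + C (i : ℝ) * X))) *
    (∏ j, ((X - C (C (c j))) ^ 2 + C (X ^ 2))) * G.map C
  have hHm : H.Monic := by
    refine ((monic_prod_of_monic _ _ fun i _ => monic_X_sub_C _).mul
      (monic_prod_of_monic _ _ fun j _ => ?_)).mul (hGm.map _)
    refine ((monic_X_sub_C _).pow 2).add_of_left (degree_C_le.trans_lt ?_)
    rw [degree_pow, degree_X_sub_C]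
    norm_num
  let Q : ℝ → ℝ[X] := fun ε => H.map (evalRingHom ε)
  have hQ : ∀ ε, Q ε = (∏ i : Fin s, (X - C (r i + i * ε))) *
      (∏ j, ((X - C (c j)) ^ 2 + C (ε ^ 2))) * G := by
    intro ε
    have hc : (evalRingHom ε).comp C = RingHom.id ℝ := by ext; simp
    simp [Q, H, Polynomial.map_mul, Polynomial.map_prod, Polynomial.map_map, hc]
  have hQm : ∀ ε, (Q ε).Monic := fun ε => hHm.map _
  have hQ0 : Q 0 = F := by
    rw [hQ, ← hG, huv]
    simp only [Multiset.map_add, Multiset.prod_add, Multiset.map_map, Finset.prod_map_val]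
    simp [Finset.prod_mul_distrib, sq]
  refine ⟨Q, hQm, fun ε => ?_, fun j => ?_, ?_⟩
  · rw [← hQ0, hHm.natDegree_map, hHm.natDegree_map]
  · have hcoeff : ∀ ε, (Q ε).coeff j = (H.coeff j).eval ε := fun ε => by
      rw [coeff_map, coe_evalRingHom]
    rw [← hQ0]
    simp only [hcoeff]
    exact (H.coeff j).continuous.continuousAt.mono_left nhdsWithin_le_nhds
  · have hlin : ∀ i : Fin s, Continuous fun ε : ℝ => r i + i * ε := fun i => by fun_prop
    have hrneg : ∀ i, r i < 0 := fun i => hneg _ (by rw [huv]; simp)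
    have hev1 : ∀ᶠ ε in 𝓝[>] (0 : ℝ), ∀ i : Fin s, r i + i * ε < 0 := by
      rw [eventually_all]
      intro i
      exact ((hlin i).continuousAt.eventually_lt_const (by simpa using hrneg i)).filter_mono
        nhdsWithin_le_nhds
    have hev2 : ∀ᶠ ε in 𝓝[>] (0 : ℝ), ∀ i j : Fin s, r i < r j → r i + i * ε < r j + j * ε := by
      simp only [eventually_all]
      intro i j h
      exact ((hlin i).continuousAt.eventually_lt (hlin j).continuousAt
        (by simpa using h)).filter_mono nhdsWithin_le_nhds
    filter_upwards [hev1, hev2, self_mem_nhdsWithin] with ε h1 h2 hε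
    have hε : 0 < ε := hε
    have hroots : (Q ε).roots = (Finset.univ : Finset (Fin s)).val.map fun i => r i + i * ε := by
      have hne := (hQm ε).ne_zero
      rw [hQ] at hne ⊢
      rw [roots_mul hne, roots_mul (left_ne_zero_of_mul hne), hG0, add_zero]
      have h3 : (∏ j, ((X - C (c j)) ^ 2 + C (ε ^ 2))).roots = 0 := by
        refine Multiset.eq_zero_of_forall_notMem fun x hx => ?_
        have h4 := isRoot_of_mem_roots hx
        rw [IsRoot, eval_prod, Finset.prod_eq_zero_iff] at h4
        obtain ⟨j, -, hj⟩ := h4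
        simp only [eval_add, eval_pow, eval_sub, eval_X, eval_C] at hj
        nlinarith [sq_nonneg (x - c j), pow_pos hε 2]
      rw [h3, add_zero]
      exact roots_prod_univ_X_sub_C _
    rw [hroots]
    refine ⟨?_, by simp, ?_⟩
    · refine Finset.univ.nodup.map fun i j hij => ?_
      rcases lt_trichotomy (r i) (r j) with h | h | h
      · exact absurd hij (h2 i j h).ne
      · rw [h, add_right_inj, mul_left_inj' hε.ne', Nat.cast_inj] at hij
        exact Fin.ext hij
      · exact absurd hij (h2 j i h).ne'
    · intro x hx
      obtain ⟨i, -, rfl⟩ := Multiset.mem_map.1 hx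
      exact h1 i

end Polynomial

/-- If the sign pattern `Σ_{m,n,q}` is realizable with the pair `(0, d - 2)`,
then it is realizable with every pair `(0, d - 2k)`, `k = 1, …, ⌊(d-2)/2⌋`. -/
theorem stmt7 (d m n q : ℕ) (hm : 1 ≤ m) (hn : 1 ≤ n) (hq : 1 ≤ q)
    (hsum : m + n + q = d + 1)
    (h : ∃ P : Polynomial ℝ, P.Monic ∧ P.natDegree = d ∧
      definesSigma P d n q ∧ realizesPair P 0 (d - 2)) :
    ∀ k : ℕ, 1 ≤ k → k ≤ (d - 2) / 2 →
      ∃ P : Polynomial ℝ, P.Monic ∧ P.natDegree = d ∧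
        definesSigma P d n q ∧ realizesPair P 0 (d - 2 * k) := by
  obtain ⟨P, hP, rfl, ⟨hs1, hs2, hs3⟩, hnd, hpos, hneg, h0⟩ := h
  intro k hk1 hk2
  set s := P.natDegree - 2 * k with hs
  have hdeg : 0 < P.natDegree := by omega
  have hPpos : ∀ x, 0 ≤ x → 0 < P.eval x := fun x hx =>
    eval_pos_of_forall_not_isRoot (hs1 0 (by omega)) (fun y hy hroot => by
      rw [Multiset.card_eq_zero, Multiset.filter_eq_nil] at hpos
      exact hpos y ((mem_roots hP.ne_zero).2 hroot) hy) hx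
  obtain ⟨T, hT0, hT⟩ := exists_forall_card_roots_add_C_le_one hdeg hPpos
  have hcard0 : s ≤ (P + C 0).roots.card := by
    have := Multiset.card_le_card (Multiset.filter_le (fun x => x < 0) P.roots)
    rw [hneg] at this
    rw [map_zero, add_zero]
    omega
  obtain ⟨t, ⟨ht, hts⟩, hmax⟩ := (isCompact_setOf_le_card_roots_add_C hP hdeg s T).exists_isGreatest
    ⟨0, ⟨le_rfl, hT0⟩, hcard0⟩
  set F := P + C t with hF
  have hFm : F.Monic := monic_add_C hP hdeg t
  have hFdeg : F.natDegree = P.natDegree := natDegree_add_C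
  have hFneg : ∀ r ∈ F.roots, r < 0 := by
    intro r hr
    by_contra! hr0
    have h1 := hPpos r hr0
    have h2 : P.eval r + t = 0 := by simpa [F, IsRoot] using isRoot_of_mem_roots hr
    linarith [ht.1]
  have hodd : (F.roots.toFinset.filter fun r => Odd (F.rootMultiplicity r)).card ≤ s := by
    by_contra! hlt
    have hev := eventually_card_le_card_roots_add_C (F := F) (by omega)
      (F.roots.toFinset.filter fun r => Odd (F.rootMultiplicity r))
      fun r hr => (Finset.mem_filter.1 hr).2
    obtain ⟨ε, h1, hε⟩ := ((hev.filter_mono nhdsWithin_le_nhds).and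
      (self_mem_nhdsWithin (s := Set.Ioi (0 : ℝ)))).exists
    have hε : 0 < ε := hε
    have h2 : s ≤ (P + C (t + ε)).roots.card := by
      rw [C_add, ← add_assoc]
      exact hlt.le.trans h1
    have h3 : t + ε ≤ T := by
      by_contra! h4
      have := hT _ h4
      omega
    linarith [hmax ⟨⟨by linarith [ht.1], h3⟩, h2⟩]
  obtain ⟨l, hl⟩ : ∃ l, F.roots.card = s + 2 * l := by
    obtain ⟨G, hG, hGdeg, hG0⟩ := exists_prod_multiset_X_sub_C_mul F
    have hGm : G.Monic :=
      (monic_multiset_prod_of_monic _ _ fun a _ => monic_X_sub_C a).of_mul_monic_left (hG ▸ hFm)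
    have heven : ¬ Odd G.natDegree := fun hGodd => by
      obtain ⟨x, hx⟩ := exists_isRoot_of_monic_of_odd_natDegree hGm hGodd
      have := (mem_roots hGm.ne_zero).2 hx
      simp [hG0] at this
    rw [Nat.not_odd_iff_even] at heven
    obtain ⟨g, hg⟩ := heven
    exact ⟨(F.roots.card - s) / 2, by omega⟩
  obtain ⟨Q, hQm, hQdeg, hQcoeff, hQroots⟩ := exists_tendsto_card_roots_eq hFm s l hl hodd hFneg
  have hFcoeff : ∀ j, 0 < j → F.coeff j = P.coeff j := fun j hj => by
    rw [hF, coeff_add, coeff_C_of_ne_zero hj.ne', add_zero]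
  have hF1 : ∀ j, j < q → 0 < F.coeff j := fun j hj => by
    rcases j.eq_zero_or_pos with rfl | h
    · rw [hF, coeff_add, coeff_C_zero]
      exact add_pos_of_pos_of_nonneg (hs1 0 hj) ht.1
    · rw [hFcoeff j h]
      exact hs1 j hj
  have hsign : ∀ᶠ ε in 𝓝[>] (0 : ℝ), ∀ j ∈ Finset.range (P.natDegree + 1),
      (0 < F.coeff j → 0 < (Q ε).coeff j) ∧ (F.coeff j < 0 → (Q ε).coeff j < 0) := by
    rw [Finset.eventually_all]
    intro j _
    rw [eventually_and, eventually_imp_distrib_left, eventually_imp_distrib_left]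
    exact ⟨(hQcoeff j).eventually_const_lt, (hQcoeff j).eventually_lt_const⟩
  obtain ⟨ε, hε, hnodup, hcard, hroots⟩ := (hsign.and hQroots).exists
  refine ⟨Q ε, hQm ε, (hQdeg ε).trans hFdeg, ⟨fun j hj => ?_, fun j hj1 hj2 => ?_,
    fun j hj1 hj2 => ?_⟩, hnodup, ?_, ?_, fun h => lt_irrefl _ (hroots 0 h)⟩
  · exact (hε j (Finset.mem_range.2 (by omega))).1 (hF1 j hj)
  · refine (hε j (Finset.mem_range.2 (by omega))).2 ?_
    rw [hFcoeff j (by omega)]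
    exact hs2 j hj1 hj2
  · refine (hε j (Finset.mem_range.2 (by omega))).1 ?_
    rw [hFcoeff j (by omega)]
    exact hs3 j hj1 hj2
  · rw [Multiset.card_eq_zero, Multiset.filter_eq_nil]
    exact fun r hr => (hroots r hr).not_gt
  · rw [Multiset.filter_eq_self.2 hroots, hcard]
end

section
/- Let m, n, q ≥ 1 with m + n + q = d + 1. If L(d,m,n) := −dn² + 4dm + 4dn − 4m² − 4mn − 4d + 4m > 0, then the sign pattern Σ_{m,n,q} is realizable with the pair (0, d−2). -/
open Polynomial

theorem coeff_X_mul_derivative (F : ℝ[X]) (j : ℕ) :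
    (X * derivative F).coeff j = j * F.coeff j := by
  cases j with
  | zero => simp
  | succ j => rw [coeff_X_mul, coeff_derivative]; push_cast; ring

/-- The coefficients of `(X + 1) ^ N` times a suitable quadratic polynomial are the binomial
coefficients `choose (N + 2) j` multiplied by `(j - r) * (j - s)`. -/
theorem coeff_X_add_one_pow_mul_quadratic (N : ℕ) (r s : ℝ) (j : ℕ) :
    ((X + 1) ^ N * (C ((N + 2 - r) * (N + 2 - s)) * X ^ 2 +
      C ((1 - r - s) * (N + 2) + 2 * (r * s)) * X + C (r * s)) : ℝ[X]).coeff j =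
      (j - r) * (j - s) * (N + 2).choose j := by
  set F : ℝ[X] := (X + 1) ^ (N + 2) with hF
  have key : ((X + 1) ^ N * (C ((N + 2 - r) * (N + 2 - s)) * X ^ 2 +
      C ((1 - r - s) * (N + 2) + 2 * (r * s)) * X + C (r * s)) : ℝ[X]) =
      X * derivative (X * derivative F) - C (r + s) * (X * derivative F) + C (r * s) * F := by
    rw [hF]
    simp only [derivative_mul, derivative_X, derivative_pow, derivative_add, derivative_one,
      derivative_natCast, derivative_ofNat, derivative_zero, C_add, C_sub, C_mul, map_natCast, map_one,
      map_ofNat, Nat.cast_add, Nat.cast_ofNat, Nat.add_sub_cancel,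
      show N + 2 - 1 = N + 1 by omega]
    ring
  rw [key, coeff_add, coeff_sub, coeff_C_mul, coeff_C_mul, coeff_X_mul_derivative,
    coeff_X_mul_derivative, hF, coeff_X_add_one_pow]
  ring

theorem continuous_coeff_prod_X_add_C (N : ℕ) (j : ℕ) :
    Continuous fun t : ℝ => (∏ i ∈ Finset.range N, (X + C (1 + t * i)) : ℝ[X]).coeff j := by
  induction N generalizing j with
  | zero => simpa using continuous_const
  | succ N ih =>
    simp only [Finset.prod_range_succ, mul_add _ X, coeff_add, coeff_mul_C]
    have hlin : Continuous fun t : ℝ => 1 + t * N := by fun_prop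
    refine .add ?_ ((ih j).mul hlin)
    cases j with
    | zero => simpa using continuous_const
    | succ j => simpa only [coeff_mul_X] using ih j

theorem continuous_coeff_prod_X_add_C_mul (N : ℕ) (G : ℝ[X]) (j : ℕ) :
    Continuous fun t : ℝ =>
      ((∏ i ∈ Finset.range N, (X + C (1 + t * i))) * G : ℝ[X]).coeff j := by
  simp only [coeff_mul]
  exact continuous_finsetSum _ fun x _ =>
    (continuous_coeff_prod_X_add_C N x.1).mul continuous_const

theorem roots_prod_X_add_C (N : ℕ) (t : ℝ) :
    (∏ i ∈ Finset.range N, (X + C (1 + t * i)) : ℝ[X]).roots =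
      (Multiset.range N).map fun i : ℕ => -(1 + t * i) := by
  have h : (∏ i ∈ Finset.range N, (X + C (1 + t * i)) : ℝ[X]) =
      (((Multiset.range N).map fun i : ℕ => -(1 + t * (i : ℝ))).map fun a => X - C a).prod := by
    rw [Multiset.map_map]
    simp only [Finset.prod, Finset.range_val, Function.comp_def, C_neg, sub_neg_eq_add]
  rw [h, roots_multiset_prod_X_sub_C]

theorem realizesPair_prod_X_add_C_mul (N : ℕ) {t : ℝ} (ht : 0 < t) {G : ℝ[X]} (hG0 : G ≠ 0)
    (hG : G.roots = 0) :
    realizesPair ((∏ i ∈ Finset.range N, (X + C (1 + t * i))) * G) 0 N := by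
  have hne : (∏ i ∈ Finset.range N, (X + C (1 + t * i)) : ℝ[X]) ≠ 0 :=
    (monic_prod_of_monic _ _ fun i _ => monic_X_add_C _).ne_zero
  have hneg : ∀ x ∈ (Multiset.range N).map fun i : ℕ => -(1 + t * (i : ℝ)), x < 0 := by
    intro x hx
    obtain ⟨i, -, rfl⟩ := Multiset.mem_map.1 hx
    have : 0 ≤ t * (i : ℝ) := by positivity
    linarith
  unfold realizesPair
  rw [roots_mul (mul_ne_zero hne hG0), hG, add_zero, roots_prod_X_add_C]
  refine ⟨?_, ?_, ?_, fun h => lt_irrefl _ (hneg 0 h)⟩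
  · refine (Multiset.nodup_range N).map fun i j hij => ?_
    have : t * (i : ℝ) = t * j := by simpa using hij
    exact_mod_cast mul_left_cancel₀ ht.ne' this
  · rw [Multiset.filter_eq_nil.2 fun x hx => (hneg x hx).not_gt]
    simp
  · rw [Multiset.filter_eq_self.2 hneg]
    simp

theorem roots_quadratic_eq_zero {a b c : ℝ} (h : b ^ 2 < 4 * a * c) :
    (C a * X ^ 2 + C b * X + C c : ℝ[X]).roots = 0 := by
  refine Multiset.eq_zero_of_forall_notMem fun x hx => ?_
  have hx := isRoot_of_mem_roots hx
  simp only [IsRoot.def, eval_add, eval_mul, eval_C, eval_pow, eval_X] at hx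
  have : (2 * a * x + b) ^ 2 = b ^ 2 - 4 * a * c := by linear_combination 4 * a * hx
  linarith [sq_nonneg (2 * a * x + b)]

open Filter Topology in
/-- If `(X + 1) ^ N * G` has the sign pattern `Σ_{m,n,q}` and the monic quadratic polynomial `G`
has no real roots, then the sign pattern is realizable with the pair `(0, N)`. -/
theorem exists_realizesPair_of_definesSigma {N n q : ℕ} {G : ℝ[X]} (hm : G.Monic)
    (hdeg : G.natDegree = 2) (hG : G.roots = 0)
    (hs : definesSigma ((X + 1) ^ N * G) (N + 2) n q) (hqn : q + n ≤ N + 2) :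
    ∃ P : ℝ[X], P.Monic ∧ P.natDegree = N + 2 ∧
      definesSigma P (N + 2) n q ∧ realizesPair P 0 N := by
  set P : ℝ → ℝ[X] := fun t => (∏ i ∈ Finset.range N, (X + C (1 + t * i))) * G with hP
  have hP0 : P 0 = (X + 1) ^ N * G := by simp [hP]
  rw [← hP0] at hs
  have hcont (j : ℕ) : Continuous fun t => (P t).coeff j :=
    continuous_coeff_prod_X_add_C_mul N G j
  have hall : ∀ᶠ t in 𝓝[>] (0 : ℝ), ∀ j ∈ Finset.range (N + 3),
      ((j < q → 0 < (P t).coeff j) ∧ (q ≤ j → j < q + n → (P t).coeff j < 0)) ∧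
        (q + n ≤ j → 0 < (P t).coeff j) := by
    refine (eventually_all_finset _).2 fun j hj => nhdsWithin_le_nhds ?_
    have hj' : j ≤ N + 2 := by rw [Finset.mem_range] at hj; omega
    refine ((eventually_imp_distrib_left.2 fun h => ?_).and
      (eventually_imp_distrib_left.2 fun h => eventually_imp_distrib_left.2 fun h' => ?_)).and
      (eventually_imp_distrib_left.2 fun h => ?_)
    · exact (hcont j).continuousAt.eventually_const_lt (hs.1 j h)
    · exact (hcont j).continuousAt.eventually_lt_const (hs.2.1 j h h')
    · exact (hcont j).continuousAt.eventually_const_lt (hs.2.2 j h hj')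
  obtain ⟨t, ht, ht0⟩ := (hall.and self_mem_nhdsWithin).exists
  have hmon : (∏ i ∈ Finset.range N, (X + C (1 + t * i)) : ℝ[X]).Monic :=
    monic_prod_of_monic _ _ fun i _ => monic_X_add_C _
  refine ⟨P t, hmon.mul hm, ?_, ⟨fun j hj => ?_, fun j hj hj' => ?_, fun j hj hj' => ?_⟩,
    realizesPair_prod_X_add_C_mul N ht0 hm.ne_zero hG⟩
  · rw [hP]
    dsimp only
    rw [hmon.natDegree_mul hm, hdeg, natDegree_prod_of_monic _ _ fun i _ => monic_X_add_C _]
    simp only [natDegree_X_add_C, Finset.sum_const, Finset.card_range, smul_eq_mul, mul_one]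
  · exact (ht j (Finset.mem_range.2 (by omega))).1.1 hj
  · exact (ht j (Finset.mem_range.2 (by omega))).1.2 hj hj'
  · exact (ht j (Finset.mem_range.2 (by omega))).2 hj

open Filter Topology in
/-- If `L(d,m,n) := −dn² + 4dm + 4dn − 4m² − 4mn − 4d + 4m > 0`, then the sign
pattern `Σ_{m,n,q}` is realizable with the pair `(0, d - 2)`. -/
theorem stmt11 (d m n q : ℕ) (hm : 1 ≤ m) (hn : 1 ≤ n) (hq : 1 ≤ q)
    (hsum : m + n + q = d + 1)
    (hL : 0 < -(d : ℤ) * n ^ 2 + 4 * d * m + 4 * d * n - 4 * m ^ 2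
            - 4 * m * n - 4 * d + 4 * m) :
    ∃ P : Polynomial ℝ, P.Monic ∧ P.natDegree = d ∧
      definesSigma P d n q ∧ realizesPair P 0 (d - 2) := by
  obtain ⟨N, rfl⟩ : ∃ N, d = N + 2 := ⟨d - 2, by omega⟩
  have hLr : (0 : ℝ) < -((N : ℝ) + 2) * n ^ 2 + 4 * (N + 2) * m + 4 * (N + 2) * n - 4 * m ^ 2
      - 4 * m * n - 4 * (N + 2) + 4 * m := by exact_mod_cast hL
  have hmr : (m : ℝ) = N + 3 - n - q := by
    have : (m : ℝ) + n + q = N + 2 + 1 := by exact_mod_cast hsum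
    linarith
  have hm1 : (1 : ℝ) ≤ m := by exact_mod_cast hm
  have hn1 : (1 : ℝ) ≤ n := by exact_mod_cast hn
  have hq1 : (1 : ℝ) ≤ q := by exact_mod_cast hq
  have hev : ∀ᶠ e in 𝓝[>] (0 : ℝ),
      ((1 - (q - e) - (q + n - 1 + e)) * ((N : ℝ) + 2) + 2 * ((q - e) * (q + n - 1 + e))) ^ 2 <
        4 * ((N + 2 - (q - e)) * (N + 2 - (q + n - 1 + e))) * ((q - e) * (q + n - 1 + e)) := by
    refine nhdsWithin_le_nhds (ContinuousAt.eventually_lt (by fun_prop) (by fun_prop) ?_)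
    rw [hmr] at hLr
    have := mul_pos (show (0 : ℝ) < N + 2 by positivity) hLr
    rw [← sub_pos]
    ring_nf at this ⊢
    exact this
  obtain ⟨e, hdisc, he0, he1⟩ := (hev.and (Ioo_mem_nhdsGT (zero_lt_one (α := ℝ)))).exists
  set r : ℝ := q - e with hr
  set s : ℝ := q + n - 1 + e with hs
  set A : ℝ := (N + 2 - r) * (N + 2 - s) with hA
  set B : ℝ := (1 - r - s) * (N + 2) + 2 * (r * s) with hB
  have hApos : 0 < A := mul_pos (by linarith) (by linarith)
  set G : ℝ[X] := C 1 * X ^ 2 + C (A⁻¹ * B) * X + C (A⁻¹ * (r * s)) with hGdef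
  have hcoeff (j : ℕ) : ((X + 1) ^ N * G).coeff j =
      A⁻¹ * ((j - r) * (j - s) * (N + 2).choose j) := by
    rw [← coeff_X_add_one_pow_mul_quadratic, ← coeff_C_mul]
    congr 1
    have h1 : (C A⁻¹ * C A : ℝ[X]) = C 1 := by rw [← C_mul, inv_mul_cancel₀ hApos.ne']
    rw [hGdef, ← hA, ← hB, ← h1]
    simp only [C_mul]
    ring
  have hGdeg : G.natDegree = 2 := natDegree_quadratic one_ne_zero
  have hGmonic : G.Monic := by
    rw [Monic, hGdef]
    exact leadingCoeff_quadratic one_ne_zero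
  have hGroots : G.roots = 0 := by
    refine roots_quadratic_eq_zero ?_
    have : 0 < A⁻¹ ^ 2 := by positivity
    have h2 := mul_lt_mul_of_pos_left hdisc this
    calc (A⁻¹ * B) ^ 2 = A⁻¹ ^ 2 * B ^ 2 := by ring
      _ < A⁻¹ ^ 2 * (4 * A * (r * s)) := h2
      _ = 4 * 1 * (A⁻¹ * (r * s)) := by field_simp
  have hchoose {j : ℕ} (hj : j ≤ N + 2) : (0 : ℝ) < (N + 2).choose j := by
    exact_mod_cast Nat.choose_pos hj
  have hinv : 0 < A⁻¹ := inv_pos.2 hApos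
  refine exists_realizesPair_of_definesSigma hGmonic hGdeg hGroots ⟨?_, ?_, ?_⟩ (by omega)
  · intro j hj
    have h1 : (j : ℝ) + 1 ≤ q := by exact_mod_cast hj
    rw [hcoeff]
    exact mul_pos hinv (mul_pos (mul_pos_of_neg_of_neg (by linarith) (by linarith))
      (hchoose (by omega)))
  · intro j hj hj'
    have h1 : (q : ℝ) ≤ j := by exact_mod_cast hj
    have h2 : (j : ℝ) + 1 ≤ q + n := by exact_mod_cast hj'
    rw [hcoeff]
    exact mul_neg_of_pos_of_neg hinv (mul_neg_of_neg_of_pos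
      (mul_neg_of_pos_of_neg (by linarith) (by linarith)) (hchoose (by omega)))
  · intro j hj hj'
    have h1 : (q : ℝ) + n ≤ j := by exact_mod_cast hj
    rw [hcoeff]
    exact mul_pos hinv (mul_pos (mul_pos (by linarith) (by linarith)) (hchoose hj'))
end
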